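/- Boundary gradient estimate (Proposition 4.1): Let n ≥ 2 be an integer, a > 1, and let σ : [1,a] → ℝ be continuous with σ ≥ 0 and σ(x) ≤ B₀·(x−1) and σ(x) ≤ B₀·(a−x) for some constant B₀ > 0. Let f : [0,T) × [1,a] → ℝ be a smooth solution of ∂_t f = σ(x)·( (∂_xx f)/(1 + (∂_x f)²) + (n−1)·(x·∂_x f − f)/(x² + f²) ) with f(t,1) = q and f(t,a) = p for all t. Then there exist constants A, B > 0 (depending on n, a, q, p, B₀ and f(0,·) but not on t or T) such that |∂_x f(t,1)| + |∂_x f(t,a)| ≤ A·e^{B·t} for all t ∈ [0,T). -/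

import Mathlib

open Real Set

/-- The right-hand side of the reduced line bundle mean curvature flow under Calabi symmetry. -/
noncomputable def flowRHS (n : ℕ) (a : ℝ) (σ : ℝ → ℝ) (f : ℝ → ℝ → ℝ) (t x : ℝ) : ℝ :=
  σ x * (derivWithin (derivWithin (f t) (Icc 1 a)) (Icc 1 a) x /
      (1 + (derivWithin (f t) (Icc 1 a) x) ^ 2) +
    ((n : ℝ) - 1) * (x * derivWithin (f t) (Icc 1 a) x - f t x) / (x ^ 2 + (f t x) ^ 2))

open Filter Topology

/-- At an interior local maximum the second derivative is nonpositive. -/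
lemma IsLocalMax.deriv_deriv_nonpos {h : ℝ → ℝ} {x : ℝ} (hmax : IsLocalMax h x)
    (hc : ContinuousAt h x) : deriv (deriv h) x ≤ 0 := by
  by_contra! hpos
  have hmin := isLocalMin_of_deriv_deriv_pos hpos hmax.deriv_eq_zero hc
  have hconst : h =ᶠ[𝓝 x] fun _ => h x := by
    filter_upwards [hmax, hmin] with y h₁ h₂ using le_antisymm h₁ h₂
  have := hconst.deriv.deriv_eq
  simp at this
  exact hpos.ne' this

/-- If `u` and `v` agree at `τ` and `u ≤ v` just before `τ`, then `v' ≤ u'` at `τ`. -/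
lemma HasDerivAt.le_of_eventually_le_left {u v : ℝ → ℝ} {u' v' τ : ℝ} (hu : HasDerivAt u u' τ)
    (hv : HasDerivAt v v' τ) (heq : u τ = v τ) (hle : ∀ᶠ s in 𝓝[<] τ, u s ≤ v s) : v' ≤ u' := by
  have h := hasDerivWithinAt_iff_tendsto_slope.1 ((hu.sub hv).hasDerivWithinAt (s := Iio τ))
  have hs : Iio τ \ {τ} = Iio τ := by simp
  rw [hs] at h
  have h0 : 0 ≤ u' - v' := by
    refine ge_of_tendsto h ?_
    filter_upwards [hle, self_mem_nhdsWithin] with s h₁ h₂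
    have h₂ : s < τ := h₂
    rw [slope_def_field]
    apply div_nonneg_of_nonpos <;> simp <;> linarith
  linarith

/-- A Lipschitz bound at a boundary or interior point bounds the derivative there. -/
lemma abs_derivWithin_le_of_lip {u : ℝ → ℝ} {s : Set ℝ} {x C : ℝ} (hC : 0 ≤ C)
    (h : ∀ y ∈ s, |u y - u x| ≤ C * |y - x|) : |derivWithin u s x| ≤ C := by
  by_cases hb : (𝓝[s \ {x}] x).NeBot
  · by_cases hd : DifferentiableWithinAt ℝ u s x
    · refine le_of_tendsto (hasDerivWithinAt_iff_tendsto_slope.1 hd.hasDerivWithinAt).abs ?_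
      filter_upwards [self_mem_nhdsWithin] with y hy
      have hne : 0 < |y - x| := abs_pos.2 (sub_ne_zero.2 hy.2)
      rw [slope_def_field, abs_div, div_le_iff₀ hne]
      exact h y hy.1
    · rw [derivWithin_zero_of_not_differentiableWithinAt hd]
      simpa using hC
  · rw [derivWithin_zero_of_not_accPt]
    · simpa using hC
    · rwa [accPt_principal_iff_nhdsWithin]

/-- Smooth solutions of the reduced flow with boundary values `q` and `p`. -/
structure IsFlowSolution (n : ℕ) (a q p : ℝ) (σ : ℝ → ℝ) (T : ℝ) (f : ℝ → ℝ → ℝ) : Prop where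
  smooth : ContDiffOn ℝ (⊤ : ℕ∞) (fun pt : ℝ × ℝ => f pt.1 pt.2) (Ico 0 T ×ˢ Icc 1 a)
  flow : ∀ t ∈ Ico (0 : ℝ) T, ∀ x ∈ Icc 1 a,
    derivWithin (fun s => f s x) (Ico 0 T) t = flowRHS n a σ f t x
  boundary : ∀ t ∈ Ico (0 : ℝ) T, f t 1 = q ∧ f t a = p

namespace IsFlowSolution

variable {n : ℕ} {a q p T : ℝ} {σ : ℝ → ℝ} {f : ℝ → ℝ → ℝ}

lemma neg (hf : IsFlowSolution n a q p σ T f) :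
    IsFlowSolution n a (-q) (-p) σ T (fun t x => -f t x) where
  smooth := hf.smooth.neg
  flow t ht x hx := by
    have h₁ : derivWithin (fun y => -f t y) (Icc 1 a) =
        fun y => -derivWithin (f t) (Icc 1 a) y := by
      ext y
      exact derivWithin.fun_neg
    rw [derivWithin.fun_neg, hf.flow t ht x hx]
    simp only [flowRHS, h₁, derivWithin.fun_neg]
    ring
  boundary t ht := by simp [hf.boundary t ht]

lemma contDiffOn_space (hf : IsFlowSolution n a q p σ T f) {t : ℝ} (ht : t ∈ Ico 0 T) :
    ContDiffOn ℝ (⊤ : ℕ∞) (f t) (Icc 1 a) :=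
  hf.smooth.comp (f := fun x : ℝ => (t, x)) (by fun_prop) fun _ hx => ⟨ht, hx⟩

lemma contDiffOn_time (hf : IsFlowSolution n a q p σ T f) {x : ℝ} (hx : x ∈ Icc 1 a) :
    ContDiffOn ℝ (⊤ : ℕ∞) (fun t => f t x) (Ico 0 T) :=
  hf.smooth.comp (f := fun t : ℝ => (t, x)) (by fun_prop) fun _ ht => ⟨ht, hx⟩

/-- At an interior spatial point where `f t` minus an affine function of slope `m` is maximal, the
second order term of the flow has a sign. -/
lemma flowRHS_le_of_isLocalMax (hf : IsFlowSolution n a q p σ T f) (hσ0 : ∀ x ∈ Icc 1 a, 0 ≤ σ x)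
    {t x c m : ℝ} (ht : t ∈ Ico 0 T) (hx : x ∈ Ioo 1 a)
    (hmax : IsLocalMax (fun y => f t y - (c + m * y)) x) :
    flowRHS n a σ f t x ≤ σ x * (((n : ℝ) - 1) * (x * m - f t x) / (x ^ 2 + (f t x) ^ 2)) := by
  have hnhds : Icc 1 a ∈ 𝓝 x := Icc_mem_nhds hx.1 hx.2
  have hderiv : derivWithin (f t) (Icc 1 a) =ᶠ[𝓝 x] deriv (f t) := by
    filter_upwards [Ioo_mem_nhds hx.1 hx.2] with y hy
    exact derivWithin_of_mem_nhds (Icc_mem_nhds hy.1 hy.2)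
  have hsmooth := hf.contDiffOn_space ht
  have hdiff : ∀ᶠ y in 𝓝 x, DifferentiableAt ℝ (f t) y := by
    filter_upwards [Ioo_mem_nhds hx.1 hx.2] with y hy
    exact (hsmooth.contDiffAt (Icc_mem_nhds hy.1 hy.2)).differentiableAt (by simp)
  have hsub : deriv (fun y => f t y - (c + m * y)) =ᶠ[𝓝 x] fun y => deriv (f t) y - m := by
    filter_upwards [hdiff] with y hy
    have hl : HasDerivAt (fun y => c + m * y) m y := by
      simpa using ((hasDerivAt_id y).const_mul m).const_add c
    exact (hy.hasDerivAt.sub hl).deriv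
  have h₁ : derivWithin (f t) (Icc 1 a) x = m := by
    have := hmax.deriv_eq_zero
    rw [hsub.eq_of_nhds] at this
    rw [hderiv.eq_of_nhds]
    linarith
  have h₂ : derivWithin (derivWithin (f t) (Icc 1 a)) (Icc 1 a) x ≤ 0 := by
    rw [derivWithin_of_mem_nhds hnhds, hderiv.deriv_eq]
    have hc : ContinuousAt (fun y => f t y - (c + m * y)) x :=
      hdiff.self_of_nhds.continuousAt.sub (by fun_prop)
    have := hmax.deriv_deriv_nonpos hc
    rwa [hsub.deriv_eq, deriv_sub_const] at this
  unfold flowRHS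
  rw [h₁]
  refine mul_le_mul_of_nonneg_left ?_ (hσ0 x (Ioo_subset_Icc_self hx))
  have : derivWithin (derivWithin (f t) (Icc 1 a)) (Icc 1 a) x / (1 + m ^ 2) ≤ 0 :=
    div_nonpos_of_nonpos_of_nonneg h₂ (by positivity)
  linarith

/-- Comparison with strict supersolutions that are affine in space. -/
lemma lt_of_strict_supersolution (hf : IsFlowSolution n a q p σ T f)
    (hσ0 : ∀ x ∈ Icc 1 a, 0 ≤ σ x) {c m c' m' : ℝ → ℝ}
    (hc : ∀ t, HasDerivAt c (c' t) t) (hm : ∀ t, HasDerivAt m (m' t) t)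
    (hsuper : ∀ t ∈ Ico 0 T, ∀ x ∈ Ioo 1 a,
      σ x * (((n : ℝ) - 1) * (x * m t - (c t + m t * x)) / (x ^ 2 + (c t + m t * x) ^ 2)) <
        c' t + m' t * x)
    (hinit : ∀ x ∈ Icc 1 a, f 0 x < c 0 + m 0 * x)
    (hleft : ∀ t ∈ Ico 0 T, q < c t + m t * 1) (hright : ∀ t ∈ Ico 0 T, p < c t + m t * a) :
    ∀ t ∈ Ico 0 T, ∀ x ∈ Icc 1 a, f t x < c t + m t * x := by
  intro t₁ ht₁ x₁ hx₁
  by_contra! hbad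
  have hcc : Continuous c := continuous_iff_continuousAt.2 fun t => (hc t).continuousAt
  have hmc : Continuous m := continuous_iff_continuousAt.2 fun t => (hm t).continuousAt
  set R : Set (ℝ × ℝ) := Icc 0 t₁ ×ˢ Icc 1 a
  have hsub : R ⊆ Ico 0 T ×ˢ Icc 1 a :=
    prod_mono (fun t ht => ⟨ht.1, ht.2.trans_lt ht₁.2⟩) subset_rfl
  have hcont : ContinuousOn (fun z : ℝ × ℝ => f z.1 z.2 - (c z.1 + m z.1 * z.2)) R :=
    (hf.smooth.continuousOn.mono hsub).sub (by fun_prop)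
  have hRc : IsCompact R := isCompact_Icc.prod isCompact_Icc
  set S : Set (ℝ × ℝ) := R ∩ (fun z : ℝ × ℝ => f z.1 z.2 - (c z.1 + m z.1 * z.2)) ⁻¹' Ici 0
  have hScomp : IsCompact S :=
    hRc.of_isClosed_subset (hcont.preimage_isClosed_of_isClosed hRc.isClosed isClosed_Ici)
      inter_subset_left
  have hSne : S.Nonempty := ⟨(t₁, x₁), ⟨⟨ht₁.1, le_rfl⟩, hx₁⟩, by
    simpa using hbad⟩
  obtain ⟨⟨τ, ξ⟩, ⟨⟨hτ, hξ⟩, hge⟩, hleast⟩ := hScomp.exists_isMinOn hSne continuous_fst.continuousOn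
  simp only [mem_preimage, mem_Ici, sub_nonneg] at hτ hξ hge
  have hτT : τ ∈ Ico 0 T := ⟨hτ.1, hτ.2.trans_lt ht₁.2⟩
  have hτ0 : 0 < τ := by
    rcases hτ.1.eq_or_lt with h | h
    · subst h
      exact absurd (hinit ξ hξ) (not_lt.2 hge)
    · exact h
  have hξ1 : 1 < ξ := by
    rcases hξ.1.eq_or_lt with h | h
    · subst h
      rw [(hf.boundary τ hτT).1] at hge
      exact absurd (hleft τ hτT) (not_lt.2 hge)
    · exact h
  have hξa : ξ < a := by
    rcases hξ.2.eq_or_lt with h | h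
    · subst h
      rw [(hf.boundary τ hτT).2] at hge
      exact absurd (hright τ hτT) (not_lt.2 hge)
    · exact h
  have hbefore : ∀ s ∈ Ico 0 τ, ∀ y ∈ Icc 1 a, f s y < c s + m s * y := by
    intro s hs y hy
    by_contra! h
    have hmem : (s, y) ∈ S := ⟨⟨⟨hs.1, hs.2.le.trans hτ.2⟩, hy⟩, by simpa using h⟩
    have : τ ≤ s := hleast hmem
    exact absurd hs.2 (not_lt.2 this)
  have hIco : ∀ᶠ s in 𝓝[<] τ, s ∈ Ico 0 τ := Ico_mem_nhdsLT hτ0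
  have hTn : Ico 0 T ∈ 𝓝 τ := Ico_mem_nhds hτ0 hτT.2
  have htime : ∀ y ∈ Icc 1 a, DifferentiableAt ℝ (fun s => f s y) τ := fun y hy =>
    ((hf.contDiffOn_time hy).contDiffAt hTn).differentiableAt (by simp)
  have hat : ∀ y ∈ Icc 1 a, f τ y ≤ c τ + m τ * y := by
    intro y hy
    have h₁ : Tendsto (fun s => f s y) (𝓝[<] τ) (𝓝 (f τ y)) :=
      (htime y hy).continuousAt.tendsto.mono_left nhdsWithin_le_nhds
    have h₂ : Tendsto (fun s => c s + m s * y) (𝓝[<] τ) (𝓝 (c τ + m τ * y)) :=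
      Continuous.tendsto' (by fun_prop) _ _ rfl |>.mono_left nhdsWithin_le_nhds
    refine le_of_tendsto_of_tendsto h₁ h₂ ?_
    filter_upwards [hIco] with s hs using (hbefore s hs y hy).le
  have heq : f τ ξ = c τ + m τ * ξ := le_antisymm (hat ξ hξ) hge
  have hmax : IsLocalMax (fun y => f τ y - (c τ + m τ * y)) ξ := by
    filter_upwards [Icc_mem_nhds hξ1 hξa] with y hy
    have := hat y hy
    linarith
  have hrhs := hf.flowRHS_le_of_isLocalMax hσ0 hτT ⟨hξ1, hξa⟩ hmax
  have hft : c' τ + m' τ * ξ ≤ flowRHS n a σ f τ ξ := by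
    rw [← hf.flow τ hτT ξ hξ, derivWithin_of_mem_nhds hTn]
    refine (htime ξ hξ).hasDerivAt.le_of_eventually_le_left
      ((hc τ).add ((hm τ).mul_const ξ)) heq ?_
    filter_upwards [hIco] with s hs using (hbefore s hs ξ hξ).le
  have := hsuper τ hτT ξ ⟨hξ1, hξa⟩
  rw [heq] at hrhs
  linarith

/-- The linear barrier at `x = 1`. -/
lemma le_left_barrier (hf : IsFlowSolution n a q p σ T f) (hn : 1 ≤ n) (ha : 1 < a) {B₀ C : ℝ}
    (hB₀ : 0 < B₀) (hσ0 : ∀ x ∈ Icc 1 a, 0 ≤ σ x) (hσ1 : ∀ x ∈ Icc 1 a, σ x ≤ B₀ * (x - 1))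
    (hC : 0 < C) (hqC : |q| ≤ C) (hinit : ∀ x ∈ Icc 1 a, f 0 x ≤ q + C * (x - 1)) :
    ∀ t ∈ Ico 0 T, ∀ x ∈ Icc 1 a,
      f t x ≤ q + C * exp ((2 * B₀ * ((n : ℝ) - 1) + 1) * t) * (x - 1) := by
  intro t ht x hx
  refine le_of_forall_pos_lt_add fun ε hε => ?_
  set B : ℝ := 2 * B₀ * ((n : ℝ) - 1) + 1 with hB
  have hn' : (0 : ℝ) ≤ (n : ℝ) - 1 := by
    have : (1 : ℝ) ≤ n := by exact_mod_cast hn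
    linarith
  have hB0 : 0 < B := by positivity
  have hT : 0 < T := ht.1.trans_lt ht.2
  have hp : p ≤ q + C * (a - 1) := by
    have := hinit a ⟨ha.le, le_rfl⟩
    rwa [(hf.boundary 0 ⟨le_rfl, hT⟩).2] at this
  have hm : ∀ t, HasDerivAt (fun t => C * exp (B * t)) (B * (C * exp (B * t))) t := fun t => by
    have := (((hasDerivAt_id t).const_mul B).exp).const_mul C
    refine this.congr_deriv ?_
    simp only [id]
    ring
  have hmC : ∀ t ∈ Ico 0 T, C ≤ C * exp (B * t) := fun t ht =>
    le_mul_of_one_le_right hC.le (one_le_exp (mul_nonneg hB0.le ht.1))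
  have key := hf.lt_of_strict_supersolution hσ0
    (c := fun t => q + ε - C * exp (B * t)) (m := fun t => C * exp (B * t))
    (fun t => (hm t).const_sub (q + ε)) hm ?_ ?_ ?_ ?_ t ht x hx
  · linarith
  · intro t ht x hx
    have h₁ := hmC t ht
    set m := C * exp (B * t)
    have hq := abs_le.1 hqC
    have hx0 : 0 < x - 1 := sub_pos.2 hx.1
    have hD : 1 ≤ x ^ 2 + (q + ε - m + m * x) ^ 2 := by
      nlinarith [hx.1, sq_nonneg (q + ε - m + m * x)]
    have hm0 : 0 < m := hC.trans_le h₁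
    have h₂ : ((n : ℝ) - 1) * (x * m - (q + ε - m + m * x)) / (x ^ 2 + (q + ε - m + m * x) ^ 2) ≤
        ((n : ℝ) - 1) * (2 * m) := by
      rw [div_le_iff₀ (by linarith)]
      calc ((n : ℝ) - 1) * (x * m - (q + ε - m + m * x)) ≤ ((n : ℝ) - 1) * (2 * m) :=
            mul_le_mul_of_nonneg_left (by linarith) hn'
        _ ≤ _ := le_mul_of_one_le_right (by positivity) hD
    calc _ ≤ σ x * (((n : ℝ) - 1) * (2 * m)) :=
          mul_le_mul_of_nonneg_left h₂ (hσ0 x (Ioo_subset_Icc_self hx))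
      _ ≤ B₀ * (x - 1) * (((n : ℝ) - 1) * (2 * m)) :=
          mul_le_mul_of_nonneg_right (hσ1 x (Ioo_subset_Icc_self hx)) (by positivity)
      _ < -(B * m) + B * m * x := by
          have : 0 < m * (x - 1) := by positivity
          rw [hB]
          linarith
  · intro x hx
    have := hinit x hx
    simp only [mul_zero, exp_zero]
    linarith
  · intro t ht
    linarith
  · intro t ht
    have : C * (a - 1) ≤ C * exp (B * t) * (a - 1) :=
      mul_le_mul_of_nonneg_right (hmC t ht) (by linarith)
    linarith

/-- The linear barrier at `x = a`. -/
lemma le_right_barrier (hf : IsFlowSolution n a q p σ T f) (hn : 1 ≤ n) (ha : 1 < a) {B C : ℝ}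
    (hB : 0 < B) (hσ0 : ∀ x ∈ Icc 1 a, 0 ≤ σ x)
    (hC : 0 < C) (hpC : |p| ≤ C) (hinit : ∀ x ∈ Icc 1 a, f 0 x ≤ p + C * (a - x)) :
    ∀ t ∈ Ico 0 T, ∀ x ∈ Icc 1 a, f t x ≤ p + C * exp (B * t) * (a - x) := by
  intro t ht x hx
  refine le_of_forall_pos_lt_add fun ε hε => ?_
  have hn' : (0 : ℝ) ≤ (n : ℝ) - 1 := by
    have : (1 : ℝ) ≤ n := by exact_mod_cast hn
    linarith
  have hT : 0 < T := ht.1.trans_lt ht.2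
  have hq : q ≤ p + C * (a - 1) := by
    have := hinit 1 ⟨le_rfl, ha.le⟩
    rwa [(hf.boundary 0 ⟨le_rfl, hT⟩).1] at this
  have hm : ∀ t, HasDerivAt (fun t => C * exp (B * t)) (B * (C * exp (B * t))) t := fun t => by
    have := (((hasDerivAt_id t).const_mul B).exp).const_mul C
    refine this.congr_deriv ?_
    simp only [id]
    ring
  have hmC : ∀ t ∈ Ico 0 T, C ≤ C * exp (B * t) := fun t ht =>
    le_mul_of_one_le_right hC.le (one_le_exp (mul_nonneg hB.le ht.1))
  have key := hf.lt_of_strict_supersolution hσ0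
    (c := fun t => p + ε + C * exp (B * t) * a) (m := fun t => -(C * exp (B * t)))
    (fun t => ((hm t).mul_const a).const_add (p + ε)) (fun t => (hm t).neg) ?_ ?_ ?_ ?_ t ht x hx
  · linarith
  · intro t ht x hx
    have h₁ := hmC t ht
    set m := C * exp (B * t)
    have hm0 : 0 < m := hC.trans_le h₁
    have hma : m ≤ m * a := le_mul_of_one_le_right hm0.le ha.le
    have hp := abs_le.1 hpC
    have hpos : 0 < B * m * (a - x) := mul_pos (mul_pos hB hm0) (sub_pos.2 hx.2)
    have h₂ : σ x * (((n : ℝ) - 1) * (x * -m - (p + ε + m * a + -m * x)) /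
        (x ^ 2 + (p + ε + m * a + -m * x) ^ 2)) ≤ 0 := by
      refine mul_nonpos_of_nonneg_of_nonpos (hσ0 x (Ioo_subset_Icc_self hx)) ?_
      refine div_nonpos_of_nonpos_of_nonneg ?_ (by positivity)
      exact mul_nonpos_of_nonneg_of_nonpos hn' (by linarith)
    linarith
  · intro x hx
    have := hinit x hx
    simp only [mul_zero, exp_zero]
    linarith
  · intro t ht
    have : C * (a - 1) ≤ C * exp (B * t) * (a - 1) :=
      mul_le_mul_of_nonneg_right (hmC t ht) (by linarith)
    linarith
  · intro t ht
    linarith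

/-- Exponential bounds for both boundary derivatives. -/
lemma abs_boundary_deriv_le (hf : IsFlowSolution n a q p σ T f) (hn : 1 ≤ n) (ha : 1 < a)
    {B₀ C : ℝ} (hB₀ : 0 < B₀) (hσ0 : ∀ x ∈ Icc 1 a, 0 ≤ σ x)
    (hσ1 : ∀ x ∈ Icc 1 a, σ x ≤ B₀ * (x - 1)) (hC : 0 < C) (hqC : |q| ≤ C) (hpC : |p| ≤ C)
    (hinit₁ : ∀ x ∈ Icc 1 a, |f 0 x - q| ≤ C * (x - 1))
    (hinit₂ : ∀ x ∈ Icc 1 a, |f 0 x - p| ≤ C * (a - x)) {t : ℝ} (ht : t ∈ Ico 0 T) :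
    |derivWithin (f t) (Icc 1 a) 1| ≤ C * exp ((2 * B₀ * ((n : ℝ) - 1) + 1) * t) ∧
      |derivWithin (f t) (Icc 1 a) a| ≤ C * exp ((2 * B₀ * ((n : ℝ) - 1) + 1) * t) := by
  have hn' : (0 : ℝ) ≤ (n : ℝ) - 1 := by
    have : (1 : ℝ) ≤ n := by exact_mod_cast hn
    linarith
  have hB : 0 < 2 * B₀ * ((n : ℝ) - 1) + 1 := by positivity
  constructor
  · refine abs_derivWithin_le_of_lip (by positivity) fun x hx => ?_
    have hu := hf.le_left_barrier hn ha hB₀ hσ0 hσ1 hC hqC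
      (fun x hx => by linarith [(abs_le.1 (hinit₁ x hx)).2]) t ht x hx
    have hl := hf.neg.le_left_barrier hn ha hB₀ hσ0 hσ1 hC (by rwa [abs_neg])
      (fun x hx => by linarith [(abs_le.1 (hinit₁ x hx)).1]) t ht x hx
    rw [(hf.boundary t ht).1, abs_of_nonneg (sub_nonneg.2 hx.1), abs_le]
    constructor <;> linarith
  · refine abs_derivWithin_le_of_lip (by positivity) fun x hx => ?_
    have hu := hf.le_right_barrier hn ha hB hσ0 hC hpC
      (fun x hx => by linarith [(abs_le.1 (hinit₂ x hx)).2]) t ht x hx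
    have hl := hf.neg.le_right_barrier hn ha hB hσ0 hC (by rwa [abs_neg])
      (fun x hx => by linarith [(abs_le.1 (hinit₂ x hx)).1]) t ht x hx
    rw [(hf.boundary t ht).2, abs_sub_comm x, abs_of_nonneg (sub_nonneg.2 hx.2), abs_le]
    constructor <;> linarith

end IsFlowSolution

/-- **Boundary gradient estimate** (Proposition 4.1).  If `σ ≥ 0` with `σ(x) ≤ B₀(x−1)` and
`σ(x) ≤ B₀(a−x)`, then for any smooth solution of the reduced flow with fixed boundary
values `q`, `p` and initial data `f₀`, the boundary derivatives satisfy
`|∂ₓf(t,1)| + |∂ₓf(t,a)| ≤ A e^{Bt}`, with `A, B` independent of `t` and `T`. -/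
theorem boundary_gradient_estimate (n : ℕ) (hn : 2 ≤ n) (a q p B₀ : ℝ) (ha : 1 < a)
    (hB₀ : 0 < B₀) (σ : ℝ → ℝ) (hσc : ContinuousOn σ (Icc 1 a))
    (hσ0 : ∀ x ∈ Icc 1 a, 0 ≤ σ x)
    (hσ1 : ∀ x ∈ Icc 1 a, σ x ≤ B₀ * (x - 1))
    (hσ2 : ∀ x ∈ Icc 1 a, σ x ≤ B₀ * (a - x))
    (f₀ : ℝ → ℝ) :
    ∃ A B : ℝ, 0 < A ∧ 0 < B ∧
      ∀ T : ℝ, ∀ f : ℝ → ℝ → ℝ,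
        ContDiffOn ℝ (⊤ : ℕ∞) (fun pt : ℝ × ℝ => f pt.1 pt.2) (Ico 0 T ×ˢ Icc 1 a) →
        (∀ x ∈ Icc 1 a, f 0 x = f₀ x) →
        (∀ t ∈ Ico (0 : ℝ) T, ∀ x ∈ Icc 1 a,
          derivWithin (fun s => f s x) (Ico 0 T) t = flowRHS n a σ f t x) →
        (∀ t ∈ Ico (0 : ℝ) T, f t 1 = q ∧ f t a = p) →
        ∀ t ∈ Ico (0 : ℝ) T,
          |derivWithin (f t) (Icc 1 a) 1| + |derivWithin (f t) (Icc 1 a) a| ≤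
            A * Real.exp (B * t) := by
  by_cases hlip : ∃ K, LipschitzOnWith K f₀ (Icc 1 a)
  · obtain ⟨K, hK⟩ := hlip
    set C : ℝ := K + |q| + |p| + 1
    have hn' : (0 : ℝ) ≤ (n : ℝ) - 1 := by
      have : (2 : ℝ) ≤ n := by exact_mod_cast hn
      linarith
    have hC : 0 < C := by positivity
    have hKC : (K : ℝ) ≤ C := by linarith [abs_nonneg q, abs_nonneg p]
    refine ⟨2 * C, 2 * B₀ * ((n : ℝ) - 1) + 1, by positivity, by positivity, ?_⟩
    intro T f hsmooth h0 hflow hbd t ht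
    have hf : IsFlowSolution n a q p σ T f := ⟨hsmooth, hflow, hbd⟩
    have h1mem : (1 : ℝ) ∈ Icc 1 a := ⟨le_rfl, ha.le⟩
    have hamem : a ∈ Icc 1 a := ⟨ha.le, le_rfl⟩
    have hb := hbd 0 ⟨le_rfl, ht.1.trans_lt ht.2⟩
    have hinit₁ : ∀ x ∈ Icc 1 a, |f 0 x - q| ≤ C * (x - 1) := fun x hx => by
      have := hK.dist_le_mul x hx 1 h1mem
      rw [← h0 x hx, ← h0 1 h1mem, hb.1, Real.dist_eq, Real.dist_eq,
        abs_of_nonneg (sub_nonneg.2 hx.1)] at this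
      exact this.trans (mul_le_mul_of_nonneg_right hKC (sub_nonneg.2 hx.1))
    have hinit₂ : ∀ x ∈ Icc 1 a, |f 0 x - p| ≤ C * (a - x) := fun x hx => by
      have := hK.dist_le_mul x hx a hamem
      rw [← h0 x hx, ← h0 a hamem, hb.2, Real.dist_eq, Real.dist_eq, abs_sub_comm x,
        abs_of_nonneg (sub_nonneg.2 hx.2)] at this
      exact this.trans (mul_le_mul_of_nonneg_right hKC (sub_nonneg.2 hx.2))
    have hK0 : (0 : ℝ) ≤ K := K.2
    obtain ⟨h₁, h₂⟩ := hf.abs_boundary_deriv_le (by omega) ha hB₀ hσ0 hσ1 hC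
      (by linarith [abs_nonneg p]) (by linarith [abs_nonneg q]) hinit₁ hinit₂ ht
    linarith
  · refine ⟨1, 1, one_pos, one_pos, ?_⟩
    intro T f hsmooth h0 hflow hbd t ht
    have hf : IsFlowSolution n a q p σ T f := ⟨hsmooth, hflow, hbd⟩
    have h₀ : ContDiffOn ℝ 1 f₀ (Icc 1 a) :=
      ((hf.contDiffOn_space ⟨le_rfl, ht.1.trans_lt ht.2⟩).of_le (by simp)).congr
        fun x hx => (h0 x hx).symm
    exact absurd (h₀.exists_lipschitzOnWith one_ne_zero (convex_Icc 1 a) isCompact_Icc) hlip
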